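/- There exists a constant C > 0 such that the following holds for every n and every binary merge tree T with n leaves. For each internal node u of T, let σ(u) denote a child of u of minimum combination rank (either one if the two ranks are equal). Then ∑_u (log₂ size(σ(u)) − R(σ(u))) ≤ C·n, where the sum ranges over all internal nodes u of T. -/

import Mathlib

/-- A binary merge tree: every internal node has exactly two children. -/
inductive MergeTree : Type
  | leaf : MergeTree
  | node : MergeTree → MergeTree → MergeTree

namespace MergeTree

/-- The number of leaves of a binary merge tree. -/
def size : MergeTree → ℕ
  | leaf => 1
  | node l r => size l + size r

/-- The combination rank. -/
def rank : MergeTree → ℕ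
  | leaf => 0
  | node l r => if rank l = rank r then rank l + 1 else max (rank l) (rank r)

/-- Given a selector `sel` that at each internal node `node l r` picks one child
(`true` = left, `false` = right), the sum over all internal nodes `u` of
`log₂ size(σ(u)) − R(σ(u))` where `σ(u)` is the selected child of `u`. -/
noncomputable def selDiffSum (sel : MergeTree → MergeTree → Bool) : MergeTree → ℝ
  | leaf => 0
  | node l r =>
      (Real.logb 2 (size (if sel l r then l else r)) - (rank (if sel l r then l else r) : ℝ))
        + selDiffSum sel l + selDiffSum sel r

end MergeTree

namespace MergeTree

lemma logb_two_le_self {x : ℝ} (hx : 0 < x) : Real.logb 2 x ≤ x := by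
  have h2 := Real.log_two_gt_d9
  rw [Real.logb, div_le_iff₀ (by linarith)]
  have h := Real.log_le_sub_one_of_pos (half_pos hx)
  have h2' := Real.log_two_lt_d9
  rw [Real.log_div hx.ne' two_ne_zero] at h
  nlinarith

lemma size_pos : ∀ T : MergeTree, 0 < T.size
  | leaf => Nat.one_pos
  | node l _ => Nat.add_pos_left (size_pos l) _

lemma logb_size_sub_rank_le (T : MergeTree) :
    Real.logb 2 T.size - T.rank ≤ T.size * (1 / 2) ^ T.rank := by
  have hs : (0 : ℝ) < T.size := mod_cast T.size_pos
  have h := logb_two_le_self (x := T.size * (1 / 2) ^ T.rank) (by positivity)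
  rw [Real.logb_mul hs.ne' (by positivity), Real.logb_pow, one_div, Real.logb_inv,
    Real.logb_self_eq_one one_lt_two] at h
  rw [one_div]
  linarith

lemma rank_lt_rank_node_of_le_right {l r : MergeTree} (h : l.rank ≤ r.rank) :
    l.rank < (node l r).rank := by
  rw [rank]; split_ifs <;> omega

lemma rank_lt_rank_node_of_le_left {l r : MergeTree} (h : r.rank ≤ l.rank) :
    r.rank < (node l r).rank := by
  rw [rank]; split_ifs <;> omega

lemma rank_left_le_rank_node (l r : MergeTree) : l.rank ≤ (node l r).rank := by
  rw [rank]; split_ifs <;> omega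

lemma rank_right_le_rank_node (l r : MergeTree) : r.rank ≤ (node l r).rank := by
  rw [rank]; split_ifs <;> omega

/-- The rank strictly increases from a selected child to its parent, so halving the power of `1 / 2`
pays for the contribution of that child to `selDiffSum`. -/
lemma selDiffSum_le_size_mul (sel : MergeTree → MergeTree → Bool)
    (hsel : ∀ l r : MergeTree,
      rank (if sel l r then l else r) ≤ rank (if sel l r then r else l)) :
    ∀ T : MergeTree, T.selDiffSum sel ≤ T.size * (2 - 2 * (1 / 2) ^ T.rank)
  | leaf => by simp [selDiffSum, rank]
  | node l r => by
    have ihl := selDiffSum_le_size_mul sel hsel l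
    have ihr := selDiffSum_le_size_mul sel hsel r
    have mono : ∀ {a b : ℕ}, a ≤ b → ((1 : ℝ) / 2) ^ b ≤ (1 / 2) ^ a := fun h =>
      pow_le_pow_of_le_one (by norm_num) (by norm_num) h
    have selected : ∀ {t : MergeTree} {k : ℕ}, t.rank < k →
        Real.logb 2 t.size - t.rank + t.size * (2 - 2 * (1 / 2) ^ t.rank) ≤
          t.size * (2 - 2 * (1 / 2) ^ k) := by
      intro t k hk
      have h := mul_le_mul_of_nonneg_left (mono (Nat.succ_le_of_lt hk)) t.size.cast_nonneg
      rw [pow_succ] at h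
      linarith [t.logb_size_sub_rank_le]
    have unselected : ∀ {t : MergeTree} {k : ℕ}, t.rank ≤ k →
        t.size * (2 - 2 * ((1 : ℝ) / 2) ^ t.rank) ≤ t.size * (2 - 2 * (1 / 2) ^ k) := by
      intro t k hk
      linarith [mul_le_mul_of_nonneg_left (mono hk) t.size.cast_nonneg]
    have h := hsel l r
    rw [selDiffSum, size, Nat.cast_add, add_mul]
    cases hs : sel l r <;> simp only [hs, if_true, if_false, Bool.false_eq_true] at h ⊢
    · linarith [selected (rank_lt_rank_node_of_le_left h),
        unselected (rank_left_le_rank_node l r)]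
    · linarith [selected (rank_lt_rank_node_of_le_right h),
        unselected (rank_right_le_rank_node l r)]

end MergeTree

/-- Equation (8) of the paper: there is a universal constant `C > 0` such that for any
binary merge tree `T` with `n` leaves and any selection `σ(u)` of a minimum-rank child at
each internal node `u` (either one if the ranks are equal), we have
`∑_u (log₂ size(σ(u)) − R(σ(u))) ≤ C·n`. -/
theorem selDiffSum_le : ∃ C : ℝ, 0 < C ∧
    ∀ (n : ℕ) (T : MergeTree), T.size = n →
      ∀ sel : MergeTree → MergeTree → Bool,
        (∀ l r : MergeTree,
          MergeTree.rank (if sel l r then l else r) ≤ MergeTree.rank (if sel l r then r else l)) →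
        T.selDiffSum sel ≤ C * n := by
  refine ⟨2, two_pos, ?_⟩
  rintro n T rfl sel hsel
  refine (T.selDiffSum_le_size_mul sel hsel).trans ?_
  rw [mul_comm]
  gcongr
  linarith [pow_pos (one_half_pos (α := ℝ)) T.rank]
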